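/- arXiv:2304.07863 — 3 statements merged into one kernel-verified Lean document; each statement's English description precedes it below -/
import Mathlib

section
/- Let the index set of ℝ^{a+b+c} be partitioned into three blocks U, V, W of sizes a, b, c, let R ∈ ℝ^{(a+b+c)×(a+b+c)} be positive-definite symmetric, and let ρ = p_{μ,R} be the corresponding Gaussian density. Denote by R_UV, R_V, R_VW the principal submatrices of R on the index blocks U∪V, V, and V∪W respectively, and by R_UVW = R. Then the causation entropy C_{W→U|V} := H(U|V) − H(U|V,W), computed from ρ and its marginals ρ_UV, ρ_V, ρ_VW via H(U|V) = −∫∫ ρ_UV log(ρ_UV/ρ_V) and H(U|V,W) = −∫∫∫ ρ log(ρ/ρ_VW), equals (1/2) log det R_UV − (1/2) log det R_V − (1/2) log det R_UVW + (1/2) log det R_VW. -/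
open MeasureTheory Matrix

/-- The Gaussian density on `ℝ^ι` with mean `μ` and covariance matrix `S`:
`p_{μ,S}(x) = ((2π)^n det S)^{-1/2} exp(−(x−μ)ᵀ S⁻¹ (x−μ)/2)`. -/
noncomputable def gaussianDensity {ι : Type*} [Fintype ι] [DecidableEq ι]
    (μ : ι → ℝ) (S : Matrix ι ι ℝ) (x : ι → ℝ) : ℝ :=
  ((2 * Real.pi) ^ (Fintype.card ι) * S.det) ^ (-(1 / 2 : ℝ)) *
    Real.exp (-((x - μ) ⬝ᵥ (S⁻¹ *ᵥ (x - μ))) / 2)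

/-- Inclusion of the `U ∪ V` index block into `U ⊔ V ⊔ W`. -/
def emUV {a b c : ℕ} : Fin a ⊕ Fin b → Fin a ⊕ Fin b ⊕ Fin c := Sum.map id Sum.inl

/-- Inclusion of the `V` index block into `U ⊔ V ⊔ W`. -/
def emV {a b c : ℕ} : Fin b → Fin a ⊕ Fin b ⊕ Fin c := fun j => Sum.inr (Sum.inl j)

/-- Inclusion of the `V ∪ W` index block into `U ⊔ V ⊔ W`. -/
def emVW {a b c : ℕ} : Fin b ⊕ Fin c → Fin a ⊕ Fin b ⊕ Fin c := Sum.inr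

section GaussianIntegrals

variable {ι κ : Type*} [Fintype ι] [Fintype κ]

theorem integral_comp_sub_mul {m : (κ → ℝ) → ι → ℝ} {φ : (ι → ℝ) → ℝ} {ψ : (κ → ℝ) → ℝ}
    (hm : Continuous m) (hφc : Continuous φ) (hφ : Integrable φ) (hψc : Continuous ψ)
    (hψ : Integrable ψ) :
    ∫ p : (ι → ℝ) × (κ → ℝ), φ (p.1 - m p.2) * ψ p.2 = (∫ x, φ x) * ∫ y, ψ y := by
  have hint : Integrable (fun p : (ι → ℝ) × (κ → ℝ) => φ (p.1 - m p.2) * ψ p.2)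
      (volume.prod volume) := by
    have hcont : Continuous fun p : (ι → ℝ) × (κ → ℝ) => φ (p.1 - m p.2) * ψ p.2 := by fun_prop
    refine (integrable_prod_iff' hcont.aestronglyMeasurable).mpr
      ⟨.of_forall fun y => (hφ.comp_sub_right (m y)).mul_const (ψ y), ?_⟩
    have hnorm : ∀ y, ∫ x, ‖φ (x - m y)‖ = ∫ x, ‖φ x‖ :=
      fun y => integral_sub_right_eq_self (fun x => ‖φ x‖) (m y)
    simp only [norm_mul, integral_mul_const, hnorm]
    exact hψ.norm.const_mul _
  rw [Measure.volume_eq_prod, integral_prod_symm _ hint]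
  simp only [integral_mul_const, integral_sub_right_eq_self φ, integral_const_mul]

theorem exp_neg_mul_dotProduct_self (b : ℝ) (z : ι → ℝ) :
    Real.exp (-b * (z ⬝ᵥ z)) = ∏ i, Real.exp (-b * z i ^ 2) := by
  rw [← Real.exp_sum, dotProduct, Finset.mul_sum]
  simp only [sq]

theorem integrable_exp_neg_mul_dotProduct_self {b : ℝ} (hb : 0 < b) :
    Integrable fun z : ι → ℝ => Real.exp (-b * (z ⬝ᵥ z)) := by
  simp only [exp_neg_mul_dotProduct_self]
  exact Integrable.fintype_prod fun _ => integrable_exp_neg_mul_sq hb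

theorem integral_exp_neg_half_dotProduct_self :
    ∫ z : ι → ℝ, Real.exp (-(z ⬝ᵥ z) / 2) = √((2 * Real.pi) ^ Fintype.card ι) := by
  have h : ∀ z : ι → ℝ, Real.exp (-(z ⬝ᵥ z) / 2) = ∏ i, Real.exp (-(1 / 2) * z i ^ 2) := by
    intro z
    rw [← exp_neg_mul_dotProduct_self]
    ring_nf
  simp only [h]
  rw [integral_fintype_prod_volume_eq_pow (fun t : ℝ => Real.exp (-(1 / 2) * t ^ 2)),
    integral_gaussian, eq_comm, Real.sqrt_eq_iff_mul_self_eq (by positivity) (by positivity),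
    ← mul_pow, Real.mul_self_sqrt (by positivity)]
  ring_nf

theorem integrable_exp_neg_half_dotProduct_self :
    Integrable fun z : ι → ℝ => Real.exp (-(z ⬝ᵥ z) / 2) := by
  convert integrable_exp_neg_mul_dotProduct_self (ι := ι) (b := 1 / 2) (by norm_num) using 3
  ring

theorem integrable_dotProduct_self_mul_exp :
    Integrable fun z : ι → ℝ => (z ⬝ᵥ z) * Real.exp (-(z ⬝ᵥ z) / 2) := by
  refine ((integrable_exp_neg_mul_dotProduct_self (ι := ι) (b := 1 / 4)
    (by norm_num)).const_mul 4).mono' (by fun_prop) (.of_forall fun z => ?_)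
  have h0 : 0 ≤ z ⬝ᵥ z := by simpa using dotProduct_star_self_nonneg z
  rw [Real.norm_of_nonneg (by positivity)]
  have h1 := Real.add_one_le_exp ((z ⬝ᵥ z) / 4)
  have h2 : Real.exp (-(1 / 4) * (z ⬝ᵥ z)) =
      Real.exp ((z ⬝ᵥ z) / 4) * Real.exp (-(z ⬝ᵥ z) / 2) := by
    rw [← Real.exp_add]; ring_nf
  rw [h2, ← mul_assoc]
  gcongr
  linarith

variable [DecidableEq ι]

theorem Matrix.PosDef.exists_eq_transpose_mul_self {C : Matrix ι ι ℝ} (hC : C.PosDef) :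
    ∃ B : Matrix ι ι ℝ, C = Bᵀ * B := by
  open scoped MatrixOrder in
  obtain ⟨B, hB⟩ := CStarAlgebra.nonneg_iff_eq_star_mul_self.mp hC.posSemidef.nonneg
  exact ⟨B, by simpa [star_eq_conjTranspose] using hB⟩

theorem Matrix.PosDef.exists_linear_standardization {C : Matrix ι ι ℝ} (hC : C.PosDef) :
    ∃ M : Matrix ι ι ℝ, M.det ≠ 0 ∧ |M.det| = √C.det ∧
      ∀ z, (M *ᵥ z) ⬝ᵥ (C⁻¹ *ᵥ (M *ᵥ z)) = z ⬝ᵥ z := by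
  obtain ⟨B, hB⟩ := hC.exists_eq_transpose_mul_self
  have hdet : C.det = B.det * B.det := by rw [hB, det_mul, det_transpose]
  have hB0 : B.det ≠ 0 := fun h => hC.det_pos.ne' (by rw [hdet, h, zero_mul])
  have hu : IsUnit B.det := isUnit_iff_ne_zero.mpr hB0
  have hut : IsUnit Bᵀ.det := by rwa [det_transpose]
  refine ⟨Bᵀ, by rwa [det_transpose], by rw [det_transpose, hdet, Real.sqrt_mul_self_eq_abs],
    fun z => ?_⟩
  have hinv : B * C⁻¹ * Bᵀ = 1 := by
    rw [hB, Matrix.mul_inv_rev, ← Matrix.mul_assoc, Matrix.mul_nonsing_inv _ hu, Matrix.one_mul,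
      Matrix.nonsing_inv_mul _ hut]
  rw [mulVec_transpose, ← dotProduct_mulVec, ← mulVec_transpose, mulVec_mulVec, mulVec_mulVec,
    hinv, one_mulVec]

theorem measurableEmbedding_toLin' {M : Matrix ι ι ℝ} (hM : M.det ≠ 0) :
    MeasurableEmbedding (toLin' M) := by
  refine (LinearMap.isClosedEmbedding_of_injective (f := toLin' M) ?_).measurableEmbedding
  rw [LinearMap.ker_eq_bot]
  exact mulVec_injective_iff_isUnit.mpr
    ((isUnit_iff_isUnit_det M).mpr (isUnit_iff_ne_zero.mpr hM))

theorem integral_comp_inv_quadratic {C : Matrix ι ι ℝ} (hC : C.PosDef) (g : ℝ → ℝ) :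
    ∫ x : ι → ℝ, g (x ⬝ᵥ (C⁻¹ *ᵥ x)) = √C.det * ∫ z : ι → ℝ, g (z ⬝ᵥ z) := by
  obtain ⟨M, hM, hdet, hq⟩ := hC.exists_linear_standardization
  have h := (measurableEmbedding_toLin' hM).integral_map (μ := volume)
    (fun x => g (x ⬝ᵥ (C⁻¹ *ᵥ x)))
  rw [Real.map_matrix_volume_pi_eq_smul_volume_pi hM, integral_smul_measure,
    ENNReal.toReal_ofReal (abs_nonneg _), abs_inv, hdet, smul_eq_mul] at h
  simp only [toLin'_apply, hq] at h
  rw [← h, mul_inv_cancel_left₀ (Real.sqrt_pos.mpr hC.det_pos).ne']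

theorem integrable_comp_inv_quadratic {C : Matrix ι ι ℝ} (hC : C.PosDef) {g : ℝ → ℝ}
    (hg : Integrable fun z : ι → ℝ => g (z ⬝ᵥ z)) :
    Integrable fun x : ι → ℝ => g (x ⬝ᵥ (C⁻¹ *ᵥ x)) := by
  obtain ⟨M, hM, hdet, hq⟩ := hC.exists_linear_standardization
  have h := (measurableEmbedding_toLin' hM).integrable_map_iff (μ := volume)
    (g := fun x => g (x ⬝ᵥ (C⁻¹ *ᵥ x)))
  rw [Real.map_matrix_volume_pi_eq_smul_volume_pi hM, integrable_smul_measure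
    (by simpa using hM) ENNReal.ofReal_ne_top] at h
  rw [h]
  simpa only [Function.comp_def, toLin'_apply, hq] using hg

end GaussianIntegrals

section GaussianDensity

variable {ι κ : Type*} [Fintype ι] [DecidableEq ι] [Fintype κ] [DecidableEq κ]

/-- `gaussianDensity` with its normalizing constant as a product of inverse square roots. -/
theorem gaussianDensity_eq_inv_sqrt {C : Matrix ι ι ℝ} (hC : C.PosDef) (μ x : ι → ℝ) :
    gaussianDensity μ C x = (√((2 * Real.pi) ^ Fintype.card ι))⁻¹ * (√C.det)⁻¹ *
      Real.exp (-((x - μ) ⬝ᵥ (C⁻¹ *ᵥ (x - μ))) / 2) := by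
  have := hC.det_pos
  rw [gaussianDensity, Real.rpow_neg (by positivity), ← Real.sqrt_eq_rpow,
    Real.sqrt_mul (by positivity), mul_inv]

theorem gaussianDensity_pos {C : Matrix ι ι ℝ} (hC : C.PosDef) (μ x : ι → ℝ) :
    0 < gaussianDensity μ C x := by
  have := hC.det_pos
  rw [gaussianDensity_eq_inv_sqrt hC]
  positivity

theorem continuous_gaussianDensity (μ : ι → ℝ) (C : Matrix ι ι ℝ) :
    Continuous (gaussianDensity μ C) := by
  unfold gaussianDensity
  fun_prop

theorem gaussianDensity_eq_zero_sub (μ : ι → ℝ) (C : Matrix ι ι ℝ) (x : ι → ℝ) :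
    gaussianDensity μ C x = gaussianDensity 0 C (x - μ) := by
  simp [gaussianDensity]

theorem integral_gaussianDensity {C : Matrix ι ι ℝ} (hC : C.PosDef) (μ : ι → ℝ) :
    ∫ x, gaussianDensity μ C x = 1 := by
  have := hC.det_pos
  simp only [gaussianDensity_eq_zero_sub μ]
  rw [integral_sub_right_eq_self (gaussianDensity 0 C)]
  simp only [gaussianDensity_eq_inv_sqrt hC, sub_zero]
  rw [integral_const_mul, integral_comp_inv_quadratic hC (fun t => Real.exp (-t / 2)),
    integral_exp_neg_half_dotProduct_self]
  field_simp

theorem integrable_gaussianDensity {C : Matrix ι ι ℝ} (hC : C.PosDef) (μ : ι → ℝ) :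
    Integrable (gaussianDensity μ C) :=
  .of_integral_ne_zero (by simp [integral_gaussianDensity hC])

theorem log_gaussianDensity_zero {C : Matrix ι ι ℝ} (hC : C.PosDef) (x : ι → ℝ) :
    Real.log (gaussianDensity 0 C x) = -(1 / 2) * Real.log ((2 * Real.pi) ^ Fintype.card ι) -
      1 / 2 * Real.log C.det - (x ⬝ᵥ (C⁻¹ *ᵥ x)) / 2 := by
  have := hC.det_pos
  rw [gaussianDensity_eq_inv_sqrt hC, Real.log_mul (by positivity) (by positivity),
    Real.log_mul (by positivity) (by positivity), Real.log_inv, Real.log_inv, Real.log_sqrt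
    (by positivity), Real.log_sqrt (by positivity), Real.log_exp, sub_zero]
  ring

theorem integrable_gaussianDensity_mul_quadratic {C : Matrix ι ι ℝ} (hC : C.PosDef) :
    Integrable fun x => gaussianDensity 0 C x * (x ⬝ᵥ (C⁻¹ *ᵥ x)) := by
  have h := (integrable_comp_inv_quadratic hC (g := fun t => t * Real.exp (-t / 2))
    integrable_dotProduct_self_mul_exp).const_mul
      ((√((2 * Real.pi) ^ Fintype.card ι))⁻¹ * (√C.det)⁻¹)
  refine h.congr (.of_forall fun x => ?_)
  simp only [gaussianDensity_eq_inv_sqrt hC, sub_zero]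
  ring

theorem integral_gaussianDensity_mul_quadratic {C : Matrix ι ι ℝ} (hC : C.PosDef) :
    ∫ x, gaussianDensity 0 C x * (x ⬝ᵥ (C⁻¹ *ᵥ x)) =
      (√((2 * Real.pi) ^ Fintype.card ι))⁻¹ *
        ∫ z : ι → ℝ, (z ⬝ᵥ z) * Real.exp (-(z ⬝ᵥ z) / 2) := by
  have := hC.det_pos
  have h := integral_comp_inv_quadratic hC (fun t => t * Real.exp (-t / 2))
  rw [← inv_mul_eq_iff_eq_mul₀ (by positivity)] at h
  rw [← h, ← integral_const_mul, ← integral_const_mul]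
  congr with x
  simp only [gaussianDensity_eq_inv_sqrt hC, sub_zero]
  ring

theorem gaussianDensity_mul_log {C : Matrix ι ι ℝ} (hC : C.PosDef) (x : ι → ℝ) :
    gaussianDensity 0 C x * Real.log (gaussianDensity 0 C x) =
      (-(1 / 2) * Real.log ((2 * Real.pi) ^ Fintype.card ι) - 1 / 2 * Real.log C.det) *
        gaussianDensity 0 C x - 1 / 2 * (gaussianDensity 0 C x * (x ⬝ᵥ (C⁻¹ *ᵥ x))) := by
  rw [log_gaussianDensity_zero hC]
  ring

theorem integrable_gaussianDensity_mul_log {C : Matrix ι ι ℝ} (hC : C.PosDef) :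
    Integrable fun x => gaussianDensity 0 C x * Real.log (gaussianDensity 0 C x) := by
  simp only [gaussianDensity_mul_log hC]
  exact ((integrable_gaussianDensity hC 0).const_mul _).sub
    ((integrable_gaussianDensity_mul_quadratic hC).const_mul _)

variable (ι) in
/-- The differential entropy of the standard Gaussian on `ℝ^ι`. -/
noncomputable def standardGaussianEntropy : ℝ :=
  1 / 2 * Real.log ((2 * Real.pi) ^ Fintype.card ι) +
    1 / 2 * ((√((2 * Real.pi) ^ Fintype.card ι))⁻¹ *
      ∫ z : ι → ℝ, (z ⬝ᵥ z) * Real.exp (-(z ⬝ᵥ z) / 2))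

theorem integral_gaussianDensity_mul_log {C : Matrix ι ι ℝ} (hC : C.PosDef) :
    ∫ x, gaussianDensity 0 C x * Real.log (gaussianDensity 0 C x) =
      -standardGaussianEntropy ι - 1 / 2 * Real.log C.det := by
  simp only [gaussianDensity_mul_log hC]
  rw [integral_sub ((integrable_gaussianDensity hC 0).const_mul _)
    ((integrable_gaussianDensity_mul_quadratic hC).const_mul _), integral_const_mul,
    integral_const_mul, integral_gaussianDensity hC, integral_gaussianDensity_mul_quadratic hC,
    standardGaussianEntropy]
  ring

theorem gaussianDensity_submatrix_equiv (e : κ ≃ ι) (μ x : ι → ℝ) (S : Matrix ι ι ℝ) :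
    gaussianDensity (μ ∘ e) (S.submatrix e e) (x ∘ e) = gaussianDensity μ S x := by
  have h : x ∘ e - μ ∘ e = (x - μ) ∘ e := rfl
  rw [gaussianDensity, gaussianDensity, det_submatrix_equiv_self, Fintype.card_congr e,
    inv_submatrix_equiv, h, submatrix_mulVec_equiv, Function.comp_assoc, Equiv.self_comp_symm,
    Function.comp_id, comp_equiv_dotProduct_comp_equiv]

end GaussianDensity

section Conditioning

variable {ι κ : Type*}

theorem Matrix.PosDef.toBlocks₂₂ {S : Matrix (ι ⊕ κ) (ι ⊕ κ) ℝ} (hS : S.PosDef) :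
    S.toBlocks₂₂.PosDef :=
  hS.submatrix Sum.inr_injective

theorem Matrix.PosDef.eq_fromBlocks_transpose {S : Matrix (ι ⊕ κ) (ι ⊕ κ) ℝ} (hS : S.PosDef) :
    S = fromBlocks S.toBlocks₁₁ S.toBlocks₁₂ S.toBlocks₁₂ᵀ S.toBlocks₂₂ := by
  have h : S.toBlocks₂₁ = S.toBlocks₁₂ᵀ := by
    ext i j
    exact (hS.isHermitian.apply _ _).symm
  rw [← h, fromBlocks_toBlocks]

variable [Fintype κ] [DecidableEq κ]

/-- The Schur complement of the second diagonal block: the conditional covariance of the first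
block of coordinates given the second. -/
noncomputable def condCov (S : Matrix (ι ⊕ κ) (ι ⊕ κ) ℝ) : Matrix ι ι ℝ :=
  S.toBlocks₁₁ - S.toBlocks₁₂ * S.toBlocks₂₂⁻¹ * S.toBlocks₁₂ᵀ

/-- The conditional mean of the first block of coordinates given that the second is `y`. -/
noncomputable def condMean (μ : ι ⊕ κ → ℝ) (S : Matrix (ι ⊕ κ) (ι ⊕ κ) ℝ) (y : κ → ℝ) : ι → ℝ :=
  μ ∘ Sum.inl + S.toBlocks₁₂ *ᵥ (S.toBlocks₂₂⁻¹ *ᵥ (y - μ ∘ Sum.inr))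

theorem continuous_condMean (μ : ι ⊕ κ → ℝ) (S : Matrix (ι ⊕ κ) (ι ⊕ κ) ℝ) :
    Continuous (condMean μ S) := by
  unfold condMean
  fun_prop

variable [Fintype ι] [DecidableEq ι]

theorem Matrix.PosDef.det_eq_mul_condCov {S : Matrix (ι ⊕ κ) (ι ⊕ κ) ℝ} (hS : S.PosDef) :
    S.det = S.toBlocks₂₂.det * (condCov S).det := by
  let := hS.toBlocks₂₂.isUnit.invertible
  conv_lhs => rw [hS.eq_fromBlocks_transpose]
  rw [det_fromBlocks₂₂, invOf_eq_nonsing_inv, condCov]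

theorem Matrix.PosDef.condCov {S : Matrix (ι ⊕ κ) (ι ⊕ κ) ℝ} (hS : S.PosDef) :
    (condCov S).PosDef := by
  let := hS.toBlocks₂₂.isUnit.invertible
  have hdet := hS.det_eq_mul_condCov
  have hpsd : (_root_.condCov S).PosSemidef := by
    have h := hS.posSemidef
    rw [hS.eq_fromBlocks_transpose, ← conjTranspose_eq_transpose_of_trivial,
      PosDef.fromBlocks₂₂ _ _ hS.toBlocks₂₂, conjTranspose_eq_transpose_of_trivial] at h
    exact h
  rw [hpsd.posDef_iff_det_ne_zero]
  intro h
  exact hS.det_pos.ne' (by rw [hdet, h, mul_zero])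

theorem Matrix.PosDef.inv_quadratic_sumElim {S : Matrix (ι ⊕ κ) (ι ⊕ κ) ℝ} (hS : S.PosDef)
    (x : ι → ℝ) (y : κ → ℝ) :
    Sum.elim x y ⬝ᵥ (S⁻¹ *ᵥ Sum.elim x y) =
      (x - S.toBlocks₁₂ *ᵥ (S.toBlocks₂₂⁻¹ *ᵥ y)) ⬝ᵥ
          ((_root_.condCov S)⁻¹ *ᵥ (x - S.toBlocks₁₂ *ᵥ (S.toBlocks₂₂⁻¹ *ᵥ y))) +
        y ⬝ᵥ (S.toBlocks₂₂⁻¹ *ᵥ y) := by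
  have hSu := (isUnit_iff_isUnit_det _).mp hS.isUnit
  have hDu := (isUnit_iff_isUnit_det _).mp hS.toBlocks₂₂.isUnit
  have hCu := (isUnit_iff_isUnit_det _).mp hS.condCov.isUnit
  have hDt : (S.toBlocks₂₂⁻¹)ᵀ = S.toBlocks₂₂⁻¹ := by
    simpa using hS.toBlocks₂₂.inv.isHermitian.eq
  set A := S.toBlocks₁₁
  set B := S.toBlocks₁₂
  set D := S.toBlocks₂₂
  set C := _root_.condCov S
  set m := B *ᵥ (D⁻¹ *ᵥ y)
  set α := C⁻¹ *ᵥ (x - m) with hα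
  have hCα : A *ᵥ α - B *ᵥ (D⁻¹ *ᵥ (Bᵀ *ᵥ α)) = x - m := by
    have h : C *ᵥ α = x - m := by rw [hα, mulVec_mulVec, mul_nonsing_inv _ hCu, one_mulVec]
    rw [← h, mulVec_mulVec α D⁻¹, mulVec_mulVec α B, ← sub_mulVec, ← Matrix.mul_assoc]
    rfl
  have hw : S *ᵥ Sum.elim α (D⁻¹ *ᵥ y - D⁻¹ *ᵥ (Bᵀ *ᵥ α)) = Sum.elim x y := by
    rw [hS.eq_fromBlocks_transpose, fromBlocks_mulVec]
    simp only [Sum.elim_comp_inl, Sum.elim_comp_inr, mulVec_sub]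
    congr 1
    · change A *ᵥ α + (m - B *ᵥ (D⁻¹ *ᵥ (Bᵀ *ᵥ α))) = x
      rw [add_sub_left_comm, hCα, add_sub_cancel]
    · change Bᵀ *ᵥ α + (D *ᵥ (D⁻¹ *ᵥ y) - D *ᵥ (D⁻¹ *ᵥ (Bᵀ *ᵥ α))) = y
      simp only [mulVec_mulVec _ D, mul_nonsing_inv _ hDu, one_mulVec, add_sub_cancel]
  have hym : y ⬝ᵥ (D⁻¹ *ᵥ (Bᵀ *ᵥ α)) = m ⬝ᵥ α := by
    rw [dotProduct_mulVec, dotProduct_mulVec, vecMul_transpose, ← mulVec_transpose, hDt]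
  have hinv : S⁻¹ *ᵥ Sum.elim x y = Sum.elim α (D⁻¹ *ᵥ y - D⁻¹ *ᵥ (Bᵀ *ᵥ α)) := by
    rw [← hw, mulVec_mulVec _ S⁻¹, nonsing_inv_mul _ hSu, one_mulVec]
  rw [hinv, sumElim_dotProduct_sumElim,
    dotProduct_sub, hym, sub_dotProduct]
  ring

theorem gaussianDensity_sumElim {S : Matrix (ι ⊕ κ) (ι ⊕ κ) ℝ} (hS : S.PosDef)
    (μ : ι ⊕ κ → ℝ) (x : ι → ℝ) (y : κ → ℝ) :
    gaussianDensity μ S (Sum.elim x y) =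
      gaussianDensity 0 (condCov S) (x - condMean μ S y) *
        gaussianDensity (μ ∘ Sum.inr) S.toBlocks₂₂ y := by
  have hsub : Sum.elim x y - μ = Sum.elim (x - μ ∘ Sum.inl) (y - μ ∘ Sum.inr) := by
    ext (i | i) <;> rfl
  rw [gaussianDensity_eq_inv_sqrt hS, gaussianDensity_eq_inv_sqrt hS.condCov,
    gaussianDensity_eq_inv_sqrt hS.toBlocks₂₂, hsub, hS.inv_quadratic_sumElim,
    hS.det_eq_mul_condCov, Real.sqrt_mul hS.toBlocks₂₂.det_pos.le, Fintype.card_sum, pow_add,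
    Real.sqrt_mul (by positivity), sub_zero, condMean, ← sub_sub, neg_add, add_div, Real.exp_add,
    mul_inv, mul_inv]
  ring

theorem integral_gaussianDensity_sumElim {S : Matrix (ι ⊕ κ) (ι ⊕ κ) ℝ} (hS : S.PosDef)
    (μ : ι ⊕ κ → ℝ) (y : κ → ℝ) :
    ∫ x : ι → ℝ, gaussianDensity μ S (Sum.elim x y) =
      gaussianDensity (μ ∘ Sum.inr) S.toBlocks₂₂ y := by
  simp only [gaussianDensity_sumElim hS]
  rw [integral_mul_const, integral_sub_right_eq_self (gaussianDensity 0 (condCov S)),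
    integral_gaussianDensity hS.condCov, one_mul]

/-- The marginal of a Gaussian density, with the coordinates split along `e`. -/
theorem integral_gaussianDensity_comp_equiv {τ : Type*} [Fintype τ] [DecidableEq τ]
    (e : ι ⊕ κ ≃ τ) {S : Matrix τ τ ℝ} (hS : S.PosDef) (μ : τ → ℝ) (y : κ → ℝ) :
    ∫ x : ι → ℝ, gaussianDensity μ S (Sum.elim x y ∘ e.symm) =
      gaussianDensity (μ ∘ e ∘ Sum.inr) (S.submatrix (e ∘ Sum.inr) (e ∘ Sum.inr)) y := by
  have h := integral_gaussianDensity_sumElim (hS.submatrix e.injective) (μ ∘ e) y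
  refine Eq.trans ?_ h
  congr with x
  rw [← gaussianDensity_submatrix_equiv e, Function.comp_assoc, e.symm_comp_self,
    Function.comp_id]

/-- The conditional differential entropy of the first block of coordinates of a Gaussian vector
given the second. -/
theorem integral_gaussianDensity_mul_log_div {S : Matrix (ι ⊕ κ) (ι ⊕ κ) ℝ} (hS : S.PosDef)
    (μ : ι ⊕ κ → ℝ) :
    ∫ p : (ι → ℝ) × (κ → ℝ), gaussianDensity μ S (Sum.elim p.1 p.2) *
        Real.log (gaussianDensity μ S (Sum.elim p.1 p.2) /
          gaussianDensity (μ ∘ Sum.inr) S.toBlocks₂₂ p.2) =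
      -standardGaussianEntropy ι - 1 / 2 * Real.log S.det +
        1 / 2 * Real.log S.toBlocks₂₂.det := by
  have hD := hS.toBlocks₂₂
  have hC := hS.condCov
  set φ : (ι → ℝ) → ℝ :=
    fun x => gaussianDensity 0 (condCov S) x * Real.log (gaussianDensity 0 (condCov S) x)
    with hφ
  have hφi : Integrable φ := integrable_gaussianDensity_mul_log hC
  have hφc : Continuous φ := (continuous_gaussianDensity _ _).mul
    ((continuous_gaussianDensity _ _).log fun x => (gaussianDensity_pos hC 0 x).ne')
  have hpt : ∀ p : (ι → ℝ) × (κ → ℝ), gaussianDensity μ S (Sum.elim p.1 p.2) *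
        Real.log (gaussianDensity μ S (Sum.elim p.1 p.2) /
          gaussianDensity (μ ∘ Sum.inr) S.toBlocks₂₂ p.2) =
      φ (p.1 - condMean μ S p.2) * gaussianDensity (μ ∘ Sum.inr) S.toBlocks₂₂ p.2 := by
    intro p
    rw [gaussianDensity_sumElim hS, mul_div_cancel_right₀ _ (gaussianDensity_pos hD _ _).ne']
    simp only [hφ]
    ring
  simp only [hpt]
  rw [integral_comp_sub_mul (continuous_condMean μ S) hφc hφi (continuous_gaussianDensity _ _)
    (integrable_gaussianDensity hD _)]
  rw [integral_gaussianDensity hD, mul_one,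
    integral_gaussianDensity_mul_log hC, hS.det_eq_mul_condCov,
    Real.log_mul hD.det_pos.ne' hC.det_pos.ne']
  ring

end Conditioning

/-- Gaussian causation entropy formula (Eq. (6) of the paper): for a Gaussian density
`ρ = p_{μ,R}` on `ℝ^{a+b+c}` with positive-definite symmetric covariance `R` and
marginals `ρ_UV`, `ρ_VW`, `ρ_V`, the causation entropy
`C_{W→U|V} = H(U|V) − H(U|V,W)` equals
`(1/2) log det R_UV − (1/2) log det R_V − (1/2) log det R_UVW + (1/2) log det R_VW`,
where each `R_•` is the principal submatrix of `R` on the corresponding blocks. -/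
theorem gaussian_causationEntropy_eq_logdet {a b c : ℕ}
    (μ : (Fin a ⊕ Fin b ⊕ Fin c) → ℝ)
    (R : Matrix (Fin a ⊕ Fin b ⊕ Fin c) (Fin a ⊕ Fin b ⊕ Fin c) ℝ)
    (hR : R.PosDef)
    (ρ : ((Fin a → ℝ) × (Fin b → ℝ) × (Fin c → ℝ)) → ℝ)
    (hρ : ∀ p, ρ p = gaussianDensity μ R (Sum.elim p.1 (Sum.elim p.2.1 p.2.2)))
    (ρUV : ((Fin a → ℝ) × (Fin b → ℝ)) → ℝ)
    (hUV : ∀ q, ρUV q = ∫ w : Fin c → ℝ, ρ (q.1, q.2, w))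
    (ρVW : ((Fin b → ℝ) × (Fin c → ℝ)) → ℝ)
    (hVW : ∀ q, ρVW q = ∫ u : Fin a → ℝ, ρ (u, q.1, q.2))
    (ρV : (Fin b → ℝ) → ℝ)
    (hV : ∀ v, ρV v = ∫ q : (Fin a → ℝ) × (Fin c → ℝ), ρ (q.1, v, q.2)) :
    (-∫ q : (Fin a → ℝ) × (Fin b → ℝ), ρUV q * Real.log (ρUV q / ρV q.2)) -
      (-∫ p : (Fin a → ℝ) × (Fin b → ℝ) × (Fin c → ℝ), ρ p * Real.log (ρ p / ρVW p.2)) =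
    (1 / 2 : ℝ) * Real.log (R.submatrix emUV emUV).det -
      (1 / 2 : ℝ) * Real.log (R.submatrix emV emV).det -
      (1 / 2 : ℝ) * Real.log R.det +
      (1 / 2 : ℝ) * Real.log (R.submatrix emVW emVW).det := by
  have hρV : ∀ v, ρV v = gaussianDensity (μ ∘ emV) (R.submatrix emV emV) v := by
    intro v
    let e : (Fin a ⊕ Fin c) ⊕ Fin b ≃ Fin a ⊕ Fin b ⊕ Fin c :=
      (Equiv.sumAssoc _ _ _).trans ((Equiv.refl _).sumCongr (Equiv.sumComm _ _))
    refine Eq.trans ?_ (integral_gaussianDensity_comp_equiv e hR μ v)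
    rw [hV, ← (volume_measurePreserving_sumPiEquivProdPi
      (fun _ : Fin a ⊕ Fin c => ℝ)).integral_comp (MeasurableEquiv.measurableEmbedding _)]
    congr with x
    rw [hρ]
    congr 1
    ext (i | i | i) <;> rfl
  have hρUV : ∀ q, ρUV q =
      gaussianDensity (μ ∘ emUV) (R.submatrix emUV emUV) (Sum.elim q.1 q.2) := by
    intro q
    let e : Fin c ⊕ (Fin a ⊕ Fin b) ≃ Fin a ⊕ Fin b ⊕ Fin c :=
      (Equiv.sumComm _ _).trans (Equiv.sumAssoc _ _ _)
    have he : e ∘ Sum.inr = emUV := by ext (i | i) <;> rfl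
    rw [← he]
    refine Eq.trans ?_ (integral_gaussianDensity_comp_equiv e hR μ (Sum.elim q.1 q.2))
    rw [hUV]
    congr with w
    rw [hρ]
    congr 1
    ext (i | i | i) <;> rfl
  have hρVW : ∀ q, ρVW q =
      gaussianDensity (μ ∘ Sum.inr) R.toBlocks₂₂ (Sum.elim q.1 q.2) := by
    intro q
    rw [hVW, ← integral_gaussianDensity_sumElim hR]
    simp only [hρ]
  have hinj : Function.Injective (emUV : Fin a ⊕ Fin b → Fin a ⊕ Fin b ⊕ Fin c) :=
    Function.injective_id.sumMap Sum.inl_injective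
  have hcondV := integral_gaussianDensity_mul_log_div (hR.submatrix hinj) (μ ∘ emUV)
  have hcondVW := integral_gaussianDensity_mul_log_div hR μ
  have hsplit : MeasurePreserving (Prod.map id
      (MeasurableEquiv.sumPiEquivProdPi (fun _ : Fin b ⊕ Fin c => ℝ)) :
        (Fin a → ℝ) × (Fin b ⊕ Fin c → ℝ) → (Fin a → ℝ) × (Fin b → ℝ) × (Fin c → ℝ)) :=
    (MeasurePreserving.id volume).prod (volume_measurePreserving_sumPiEquivProdPi _)
  have hemb : MeasurableEmbedding (Prod.map id
      (MeasurableEquiv.sumPiEquivProdPi (fun _ : Fin b ⊕ Fin c => ℝ)) :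
        (Fin a → ℝ) × (Fin b ⊕ Fin c → ℝ) → (Fin a → ℝ) × (Fin b → ℝ) × (Fin c → ℝ)) :=
    MeasurableEmbedding.id.prodMap (MeasurableEquiv.measurableEmbedding _)
  have helim : ∀ x : Fin b ⊕ Fin c → ℝ, Sum.elim
      (MeasurableEquiv.sumPiEquivProdPi (fun _ : Fin b ⊕ Fin c => ℝ) x).1
      (MeasurableEquiv.sumPiEquivProdPi (fun _ : Fin b ⊕ Fin c => ℝ) x).2 = x := by
    intro x
    ext (i | i) <;> rfl
  have hUVint : ∫ q : (Fin a → ℝ) × (Fin b → ℝ), ρUV q * Real.log (ρUV q / ρV q.2) =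
      -standardGaussianEntropy (Fin a) - 1 / 2 * Real.log (R.submatrix emUV emUV).det +
        1 / 2 * Real.log (R.submatrix emV emV).det := by
    simp only [hρUV, hρV]
    exact hcondV
  have hUVWint : ∫ p : (Fin a → ℝ) × (Fin b → ℝ) × (Fin c → ℝ), ρ p * Real.log (ρ p / ρVW p.2) =
      -standardGaussianEntropy (Fin a) - 1 / 2 * Real.log R.det +
        1 / 2 * Real.log (R.submatrix emVW emVW).det := by
    rw [← hsplit.integral_comp hemb]
    simp only [hρ, hρVW, Prod.map_fst, Prod.map_snd, id, helim]
    exact hcondVW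
  rw [hUVint, hUVWint]
  ring
end

section
/- Let the index set of ℝ^{a+b+c} be partitioned into three blocks U, V, W of sizes a, b, c, and let R ∈ ℝ^{(a+b+c)×(a+b+c)} be positive-definite symmetric. Denote by R_UV, R_V, R_VW the principal submatrices of R on the index blocks U∪V, V, and V∪W respectively. Then det(R_V) · det(R) ≤ det(R_UV) · det(R_VW); equivalently, (1/2) log det R_UV − (1/2) log det R_V − (1/2) log det R + (1/2) log det R_VW ≥ 0. -/
open Matrix

namespace Matrix

variable {m n : Type*} [Fintype m] [Fintype n] [DecidableEq m] [DecidableEq n]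

lemma PosSemidef.one_le_det_one_add {S : Matrix n n ℝ} (hS : S.PosSemidef) :
    1 ≤ (1 + S).det := by
  have h : (1 + S).det = ∏ i, (1 + hS.1.eigenvalues i) := by
    have h_charpoly := S.eval_charpoly (-1)
    rw [hS.1.charpoly_eq, Polynomial.eval_prod] at h_charpoly
    have h_neg : scalar n (-1 : ℝ) - S = -(1 + S) := by
      rw [map_neg, map_one]; abel
    have h_factor (i : n) : (-1 : ℝ) - hS.1.eigenvalues i = -(1 + hS.1.eigenvalues i) := by ring
    simp only [Polynomial.eval_sub, Polynomial.eval_X, Polynomial.eval_C, RCLike.ofReal_real_eq_id,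
      id_eq, h_neg, det_neg, h_factor, Finset.prod_neg, Finset.card_univ] at h_charpoly
    exact (mul_left_cancel₀ (pow_ne_zero _ (by norm_num)) h_charpoly).symm
  rw [h]
  exact Finset.one_le_prod fun i _ ↦ le_add_of_nonneg_right (hS.eigenvalues_nonneg i)

open scoped MatrixOrder ComplexOrder in
lemma PosDef.det_le_det_add {P Q : Matrix n n ℝ} (hP : P.PosDef) (hQ : Q.PosSemidef) :
    P.det ≤ (P + Q).det := by
  obtain ⟨B, rfl⟩ := CStarAlgebra.nonneg_iff_eq_star_mul_self.mp hQ.nonneg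
  rw [star_eq_conjTranspose, det_add_mul _ _ hP.det_pos.ne'.isUnit]
  exact le_mul_of_one_le_right hP.det_pos.le
    (hP.inv.posSemidef.mul_mul_conjTranspose_same B).one_le_det_one_add

open scoped ComplexOrder in
lemma PosDef.schur_complement₂₂ {A : Matrix m m ℝ} {B : Matrix m n ℝ} {D : Matrix n n ℝ}
    (h : (fromBlocks A B Bᴴ D).PosDef) : (A - B * D⁻¹ * Bᴴ).PosDef := by
  have hD : D.PosDef := h.submatrix Sum.inr_injective
  let _ := invertibleOfIsUnitDet D hD.det_pos.ne'.isUnit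
  have h_det := h.det_pos
  rw [det_fromBlocks₂₂, invOf_eq_nonsing_inv] at h_det
  exact ((hD.fromBlocks₂₂ A B).mp h.posSemidef).posDef_iff_det_ne_zero.mpr
    (pos_of_mul_pos_right h_det hD.det_pos.le).ne'

/-- **Fischer's inequality**. -/
lemma PosDef.det_le_det_toBlocks_mul {M : Matrix (m ⊕ n) (m ⊕ n) ℝ} (hM : M.PosDef) :
    M.det ≤ M.toBlocks₁₁.det * M.toBlocks₂₂.det := by
  obtain ⟨A, B, C, D, rfl⟩ : ∃ A B C D, M = fromBlocks A B C D :=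
    ⟨_, _, _, _, (fromBlocks_toBlocks M).symm⟩
  obtain rfl : Bᴴ = C := (isHermitian_fromBlocks_iff.mp hM.1).2.1
  have hD : D.PosDef := hM.submatrix Sum.inr_injective
  let _ := invertibleOfIsUnitDet D hD.det_pos.ne'.isUnit
  have h := hM.schur_complement₂₂.det_le_det_add
    (hD.inv.posSemidef.mul_mul_conjTranspose_same B)
  rw [sub_add_cancel] at h
  rw [det_fromBlocks₂₂, invOf_eq_nonsing_inv, toBlocks_fromBlocks₁₁, toBlocks_fromBlocks₂₂,
    mul_comm]
  exact mul_le_mul_of_nonneg_right h hD.det_pos.le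

lemma det_fromBlocks_submatrix_map {k l R : Type*} [Fintype k] [DecidableEq k] [CommRing R]
    (A : Matrix l l R) (B : Matrix l n R) (C : Matrix n l R) (D : Matrix n n R) [Invertible D]
    (f : k → l) :
    ((fromBlocks A B C D).submatrix (Sum.map f id) (Sum.map f id)).det =
      D.det * ((A - B * ⅟D * C).submatrix f f).det := by
  have h_blocks : (fromBlocks A B C D).submatrix (Sum.map f id) (Sum.map f id) =
      fromBlocks (A.submatrix f f) (B.submatrix f id) (C.submatrix id f) D := by
    ext (i | i) (j | j) <;> rfl
  rw [h_blocks, det_fromBlocks₂₂]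
  rfl

/-- The **Koteljanskii inequality** for three disjoint index blocks. -/
lemma PosDef.det_mul_det_le {l : Type*} [Fintype l] [DecidableEq l]
    {M : Matrix ((l ⊕ m) ⊕ n) ((l ⊕ m) ⊕ n) ℝ} (hM : M.PosDef) :
    M.toBlocks₂₂.det * M.det ≤
      (M.submatrix (Sum.map Sum.inl id) (Sum.map Sum.inl id)).det *
        (M.submatrix (Sum.map Sum.inr id) (Sum.map Sum.inr id)).det := by
  obtain ⟨A, B, C, D, rfl⟩ : ∃ A B C D, M = fromBlocks A B C D :=
    ⟨_, _, _, _, (fromBlocks_toBlocks M).symm⟩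
  obtain rfl : Bᴴ = C := (isHermitian_fromBlocks_iff.mp hM.1).2.1
  have hD : D.PosDef := hM.submatrix Sum.inr_injective
  let _ := invertibleOfIsUnitDet D hD.det_pos.ne'.isUnit
  rw [det_fromBlocks_submatrix_map, det_fromBlocks_submatrix_map, det_fromBlocks₂₂,
    toBlocks_fromBlocks₂₂, invOf_eq_nonsing_inv]
  have h := mul_le_mul_of_nonneg_left hM.schur_complement₂₂.det_le_det_toBlocks_mul
    (mul_self_nonneg D.det)
  calc _ = D.det * D.det * (A - B * D⁻¹ * Bᴴ).det := by ring
    _ ≤ _ := h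
    _ = _ := mul_mul_mul_comm _ _ _ _

end Matrix

/-- Nonnegativity of the Gaussian causation entropy as a determinant inequality:
for a positive-definite symmetric `R` on index blocks `U, V, W`,
`det(R_V) · det(R) ≤ det(R_UV) · det(R_VW)`; equivalently,
`(1/2) log det R_UV − (1/2) log det R_V − (1/2) log det R + (1/2) log det R_VW ≥ 0`. -/
theorem det_principal_submatrix_inequality {a b c : ℕ}
    (R : Matrix (Fin a ⊕ Fin b ⊕ Fin c) (Fin a ⊕ Fin b ⊕ Fin c) ℝ)
    (hR : R.PosDef) :
    (R.submatrix emV emV).det * R.det ≤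
        (R.submatrix emUV emUV).det * (R.submatrix emVW emVW).det ∧
      0 ≤ (1 / 2 : ℝ) * Real.log (R.submatrix emUV emUV).det -
          (1 / 2 : ℝ) * Real.log (R.submatrix emV emV).det -
          (1 / 2 : ℝ) * Real.log R.det +
          (1 / 2 : ℝ) * Real.log (R.submatrix emVW emVW).det := by
  have hV := (hR.submatrix (e := emV) (Sum.inr_injective.comp Sum.inl_injective)).det_pos
  have hUV := (hR.submatrix (e := emUV)
    (Function.injective_id.sumMap Sum.inl_injective)).det_pos
  have hVW := (hR.submatrix (e := emVW) Sum.inr_injective).det_pos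
  have h_le : (R.submatrix emV emV).det * R.det ≤
      (R.submatrix emUV emUV).det * (R.submatrix emVW emVW).det := by
    let e : (Fin a ⊕ Fin c) ⊕ Fin b ≃ Fin a ⊕ Fin b ⊕ Fin c :=
      (Equiv.sumAssoc _ _ _).trans ((Equiv.refl _).sumCongr (Equiv.sumComm _ _))
    have h := (hR.submatrix e.injective).det_mul_det_le
    have h_UV : e ∘ Sum.map Sum.inl id = emUV := by
      ext (i | i) <;> rfl
    have h_VW : e ∘ Sum.map Sum.inr id = emVW ∘ Equiv.sumComm _ _ := by
      ext (i | i) <;> rfl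
    rw [det_submatrix_equiv_self, submatrix_submatrix, submatrix_submatrix, h_UV, h_VW,
      ← submatrix_submatrix R, det_submatrix_equiv_self] at h
    exact h
  refine ⟨h_le, ?_⟩
  have h_log := Real.log_le_log (mul_pos hV hR.det_pos) h_le
  rw [Real.log_mul hV.ne' hR.det_pos.ne', Real.log_mul hUV.ne' hVW.ne'] at h_log
  linarith
end

section
/- Let the index set of ℝ^{a+b+c} be partitioned into three blocks U, V, W of sizes a, b, c, and let R ∈ ℝ^{(a+b+c)×(a+b+c)} be positive-definite symmetric with blocks R_ij for i,j ∈ {U,V,W}. Denote by R_UV, R_V, R_VW the principal submatrices of R on the index blocks U∪V, V, and V∪W respectively. Then det(R_V) · det(R) = det(R_UV) · det(R_VW) holds if and only if the conditional cross-covariance vanishes: R_UW − R_UV R_VV⁻¹ R_VW = 0. Consequently the Gaussian causation entropy (1/2)(log det R_UV − log det R_V − log det R + log det R_VW) is zero exactly when U and W are conditionally uncorrelated given V. -/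
open Matrix

/-- Inclusion of the `U` index block into `U ⊔ V ⊔ W`. -/
def emU {a b c : ℕ} : Fin a → Fin a ⊕ Fin b ⊕ Fin c := Sum.inl

/-- Inclusion of the `W` index block into `U ⊔ V ⊔ W`. -/
def emW {a b c : ℕ} : Fin c → Fin a ⊕ Fin b ⊕ Fin c := fun k => Sum.inr (Sum.inr k)

namespace Matrix

variable {m n : Type*} [Fintype m] [Fintype n] [DecidableEq m] [DecidableEq n]

open scoped MatrixOrder Matrix.Norms.L2Operator in
theorem PosDef.exists_isUnit_conjTranspose_mul_self {A : Matrix n n ℝ} (hA : A.PosDef) :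
    ∃ C : Matrix n n ℝ, IsUnit C ∧ A = Cᴴ * C :=
  CStarAlgebra.isStrictlyPositive_iff_eq_star_mul_self.mp hA.isStrictlyPositive

omit [Fintype n] [DecidableEq n] in
/-- A congruence `Bᴴ A B` by a positive definite `A` vanishes only for `B = 0`. -/
theorem PosDef.conjTranspose_mul_mul_eq_zero_iff {A : Matrix m m ℝ} (hA : A.PosDef)
    {B : Matrix m n ℝ} : Bᴴ * A * B = 0 ↔ B = 0 := by
  refine ⟨fun h => ?_, fun h => by simp [h]⟩
  obtain ⟨C, hC, rfl⟩ := hA.exists_isUnit_conjTranspose_mul_self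
  have hCB : C * B = 0 := by
    rw [← conjTranspose_mul_self_eq_zero, conjTranspose_mul, ← h]
    simp only [Matrix.mul_assoc]
  have := hC.invertible
  simpa using congrArg (C⁻¹ * ·) hCB

theorem IsHermitian.det_one_add {P : Matrix n n ℝ} (hP : P.IsHermitian) :
    (1 + P).det = ∏ i, (1 + hP.eigenvalues i) := by
  have h := congrArg (Polynomial.eval (-1)) hP.charpoly_eq
  rw [eval_charpoly, Polynomial.eval_prod] at h
  have h1 : scalar n (-1 : ℝ) - P = -(1 + P) := by
    rw [map_neg, map_one]; abel
  have h2 : ∀ i, Polynomial.eval (-1) (Polynomial.X - Polynomial.C (hP.eigenvalues i)) =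
      -(1 + hP.eigenvalues i) := fun i => by
    simp only [Polynomial.eval_sub, Polynomial.eval_X, Polynomial.eval_C]; ring
  rw [h1, det_neg] at h
  simp only [RCLike.ofReal_real_eq_id, id_eq, h2, Finset.prod_neg, Finset.card_univ] at h
  exact mul_left_cancel₀ (pow_ne_zero _ (by norm_num)) h

theorem PosSemidef.det_one_add_eq_one_iff {P : Matrix n n ℝ} (hP : P.PosSemidef) :
    (1 + P).det = 1 ↔ P = 0 := by
  refine ⟨fun h => ?_, fun h => by simp [h]⟩
  rw [hP.isHermitian.det_one_add] at h
  rw [← hP.isHermitian.eigenvalues_eq_zero_iff]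
  by_contra hne
  obtain ⟨i, hi⟩ := Function.ne_iff.mp hne
  have hlt : ∏ _i : n, (1 : ℝ) < ∏ i, (1 + hP.isHermitian.eigenvalues i) :=
    Finset.prod_lt_prod (fun _ _ => one_pos)
      (fun j _ => le_add_of_nonneg_right (hP.eigenvalues_nonneg j))
      ⟨i, Finset.mem_univ i,
        lt_add_of_pos_right _ (lt_of_le_of_ne (hP.eigenvalues_nonneg i) (Ne.symm hi))⟩
  rw [Finset.prod_const_one, h] at hlt
  exact lt_irrefl _ hlt

/-- Adding a positive semidefinite matrix to a positive definite one leaves the determinant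
unchanged only if the added matrix is zero. -/
theorem PosDef.det_add_eq_det_iff {E P : Matrix n n ℝ} (hE : E.PosDef) (hP : P.PosSemidef) :
    (E + P).det = E.det ↔ P = 0 := by
  obtain ⟨C, hC, rfl⟩ := hE.exists_isUnit_conjTranspose_mul_self
  have := hC.invertible
  have hfac : Cᴴ * C + P = Cᴴ * (1 + (C⁻¹)ᴴ * P * C⁻¹) * C := by
    rw [conjTranspose_nonsing_inv]
    simp [Matrix.mul_add, Matrix.add_mul, Matrix.mul_assoc]
  have hdet : (Cᴴ * C).det ≠ 0 := hE.det_pos.ne'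
  have hmul : (Cᴴ * C + P).det = (1 + (C⁻¹)ᴴ * P * C⁻¹).det * (Cᴴ * C).det := by
    rw [hfac]; simp only [det_mul]; ring
  rw [hmul, mul_eq_right₀ hdet, (hP.conjTranspose_mul_mul_same _).det_one_add_eq_one_iff]
  refine ⟨fun h => ?_, fun h => by simp [h]⟩
  rw [h] at hfac
  simpa using hfac

theorem PosDef.schurComplement₁₁ {A : Matrix m m ℝ} {B : Matrix m n ℝ} {D : Matrix n n ℝ}
    (h : (fromBlocks A B Bᴴ D).PosDef) : (D - Bᴴ * A⁻¹ * B).PosDef := by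
  have hA : A.PosDef := h.submatrix Sum.inl_injective
  have := hA.isUnit.invertible
  have hdet := h.det_pos
  rw [det_fromBlocks₁₁, invOf_eq_nonsing_inv] at hdet
  exact ((hA.fromBlocks₁₁ B D).mp h.posSemidef).posDef_iff_det_ne_zero.mpr
    (right_ne_zero_of_mul hdet.ne')

/-- The equality case of Fischer's inequality. -/
theorem PosDef.det_fromBlocks_eq_iff {A : Matrix m m ℝ} {B : Matrix m n ℝ} {D : Matrix n n ℝ}
    (h : (fromBlocks A B Bᴴ D).PosDef) :
    (fromBlocks A B Bᴴ D).det = A.det * D.det ↔ B = 0 := by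
  have hA : A.PosDef := h.submatrix Sum.inl_injective
  have := hA.isUnit.invertible
  have hP := hA.inv.posSemidef.conjTranspose_mul_mul_same B
  rw [det_fromBlocks₁₁, invOf_eq_nonsing_inv, mul_right_inj' hA.det_pos.ne', eq_comm]
  rw [← hA.inv.conjTranspose_mul_mul_eq_zero_iff, ← h.schurComplement₁₁.det_add_eq_det_iff hP,
    sub_add_cancel]

end Matrix

/-- For a positive-definite symmetric `R` on index blocks `U, V, W`, the equality
`det(R_V) · det(R) = det(R_UV) · det(R_VW)` holds if and only if the conditional
cross-covariance vanishes: `R_UW − R_UV R_VV⁻¹ R_VW = 0`.  Consequently, the Gaussian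
causation entropy `(1/2)(log det R_UV − log det R_V − log det R + log det R_VW)` is
zero exactly when `U` and `W` are conditionally uncorrelated given `V`. -/
theorem det_principal_submatrix_eq_iff {a b c : ℕ}
    (R : Matrix (Fin a ⊕ Fin b ⊕ Fin c) (Fin a ⊕ Fin b ⊕ Fin c) ℝ)
    (hR : R.PosDef) :
    ((R.submatrix emV emV).det * R.det =
        (R.submatrix emUV emUV).det * (R.submatrix emVW emVW).det ↔
      R.submatrix emU emW -
        R.submatrix emU emV * (R.submatrix emV emV)⁻¹ * R.submatrix emV emW = 0) ∧
    ((1 / 2 : ℝ) * (Real.log (R.submatrix emUV emUV).det -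
          Real.log (R.submatrix emV emV).det - Real.log R.det +
          Real.log (R.submatrix emVW emVW).det) = 0 ↔
      R.submatrix emU emW -
        R.submatrix emU emV * (R.submatrix emV emV)⁻¹ * R.submatrix emV emW = 0) := by
  have hV : (R.submatrix emV emV).PosDef :=
    hR.submatrix (Sum.inr_injective.comp Sum.inl_injective)
  have hUV : (R.submatrix emUV emUV).PosDef :=
    hR.submatrix (Sum.map_injective.mpr ⟨Function.injective_id, Sum.inl_injective⟩)
  have hVW : (R.submatrix emVW emVW).PosDef := hR.submatrix Sum.inr_injective
  have hsymm : ∀ {k l : ℕ} (f : Fin k → Fin a ⊕ Fin b ⊕ Fin c) (g : Fin l → _),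
      R.submatrix f g = (R.submatrix g f)ᴴ := fun f g => by
    rw [conjTranspose_submatrix, hR.isHermitian.eq]
  have := hV.isUnit.invertible
  set V := R.submatrix emV emV with hVdef
  set A := R.submatrix emU emU - R.submatrix emU emV * V⁻¹ * R.submatrix emV emU with hAdef
  set B := R.submatrix emU emW - R.submatrix emU emV * V⁻¹ * R.submatrix emV emW with hBdef
  set D := R.submatrix emW emW - R.submatrix emW emV * V⁻¹ * R.submatrix emV emW with hDdef
  have hdetUV : (R.submatrix emUV emUV).det = V.det * A.det := by
    have hblocks : R.submatrix emUV emUV =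
        fromBlocks (R.submatrix emU emU) (R.submatrix emU emV) (R.submatrix emV emU) V := by
      ext (i | i) (j | j) <;> rfl
    rw [hblocks, det_fromBlocks₂₂, invOf_eq_nonsing_inv]
  have hdetVW : (R.submatrix emVW emVW).det = V.det * D.det := by
    have hblocks : R.submatrix emVW emVW =
        fromBlocks V (R.submatrix emV emW) (R.submatrix emW emV) (R.submatrix emW emW) := by
      ext (i | i) (j | j) <;> rfl
    rw [hblocks, det_fromBlocks₁₁, invOf_eq_nonsing_inv]
  let e : Fin b ⊕ (Fin a ⊕ Fin c) ≃ Fin a ⊕ Fin b ⊕ Fin c :=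
    { toFun := Sum.elim emV (Sum.elim emU emW)
      invFun := Sum.elim (Sum.inr ∘ Sum.inl) (Sum.elim Sum.inl (Sum.inr ∘ Sum.inr))
      left_inv := by rintro (i | i | i) <;> rfl
      right_inv := by rintro (i | i | i) <;> rfl }
  let N : Matrix (Fin b) (Fin a ⊕ Fin c) ℝ :=
    fromCols (R.submatrix emV emU) (R.submatrix emV emW)
  have hNH : Nᴴ = fromRows (R.submatrix emU emV) (R.submatrix emW emV) := by
    rw [conjTranspose_fromCols_eq_fromRows_conjTranspose, ← hsymm, ← hsymm]
  have hblocks : R.submatrix e e = fromBlocks V N Nᴴ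
      (fromBlocks (R.submatrix emU emU) (R.submatrix emU emW)
        (R.submatrix emW emU) (R.submatrix emW emW)) := by
    rw [hNH]
    ext (i | i | i) (j | j | j) <;> rfl
  have hBH : R.submatrix emW emU - R.submatrix emW emV * V⁻¹ * R.submatrix emV emU = Bᴴ := by
    rw [hBdef, conjTranspose_sub, conjTranspose_mul, conjTranspose_mul, ← hsymm, ← hsymm, ← hsymm,
      hV.inv.isHermitian.eq, Matrix.mul_assoc]
  have hschur : fromBlocks (R.submatrix emU emU) (R.submatrix emU emW)
        (R.submatrix emW emU) (R.submatrix emW emW) - Nᴴ * V⁻¹ * N = fromBlocks A B Bᴴ D := by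
    rw [hNH, fromRows_mul, fromRows_mul_fromCols, sub_eq_add_neg, fromBlocks_neg, fromBlocks_add]
    simp only [← sub_eq_add_neg, hBH, hAdef, hBdef, hDdef]
  have hRe : (fromBlocks V N Nᴴ (fromBlocks (R.submatrix emU emU) (R.submatrix emU emW)
        (R.submatrix emW emU) (R.submatrix emW emW))).PosDef :=
    hblocks ▸ hR.submatrix e.injective
  have hS : (fromBlocks A B Bᴴ D).PosDef := hschur ▸ hRe.schurComplement₁₁
  have hdetR : R.det = V.det * (fromBlocks A B Bᴴ D).det := by
    rw [← det_submatrix_equiv_self e R, hblocks, det_fromBlocks₁₁, invOf_eq_nonsing_inv, hschur]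
  have hdet : V.det * R.det = (R.submatrix emUV emUV).det * (R.submatrix emVW emVW).det ↔
      B = 0 := by
    rw [← hS.det_fromBlocks_eq_iff, hdetR, hdetUV, hdetVW,
      show V.det * A.det * (V.det * D.det) = V.det * (V.det * (A.det * D.det)) by ring,
      mul_right_inj' hV.det_pos.ne', mul_right_inj' hV.det_pos.ne']
  refine ⟨hdet, ?_⟩
  rw [← hdet, ← Real.log_injOn_pos.eq_iff (mul_pos hV.det_pos hR.det_pos)
    (mul_pos hUV.det_pos hVW.det_pos), Real.log_mul hV.det_pos.ne' hR.det_pos.ne',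
    Real.log_mul hUV.det_pos.ne' hVW.det_pos.ne']
  constructor <;> intro h <;> linarith
end
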